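/- (Coverage of the Clopper–Pearson lower confidence bound used in the certification algorithm.) Let n ≥ 1, α ∈ (0,1), and p ∈ [0,1]. For k ∈ {0, …, n}, define the lower confidence bound L(k) := sSup {q ∈ [0,1] : ℙ(Bin(n, q) ≥ k) ≤ α} (with L(k) := 0 if this set is empty). If X ∼ Bin(n, p), then ℙ(L(X) > p) ≤ α; i.e. with probability at least 1 − α the bound satisfies L(X) ≤ p. -/

import Mathlib

/-- `ℙ(Bin(n, q) ≥ k) = ∑_{j ≥ k} C(n,j) q^j (1−q)^{n−j}`, the upper tail probability of the
binomial distribution with `n` trials and success probability `q`. -/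
noncomputable def binomTail (n : ℕ) (q : ℝ) (k : ℕ) : ℝ :=
  ∑ j ∈ Finset.Icc k n, (n.choose j : ℝ) * q ^ j * (1 - q) ^ (n - j)

/-- The Clopper–Pearson lower confidence bound
`L(k) = sup {q ∈ [0,1] : ℙ(Bin(n,q) ≥ k) ≤ α}` (equal to `0` if the set is empty, by the
convention `sSup ∅ = 0` for real numbers). -/
noncomputable def clopperPearsonLower (n : ℕ) (α : ℝ) (k : ℕ) : ℝ :=
  sSup {q : ℝ | q ∈ Set.Icc (0 : ℝ) 1 ∧ binomTail n q k ≤ α}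

noncomputable def bTerm (n : ℕ) (q : ℝ) (j : ℕ) : ℝ :=
  (n.choose j : ℝ) * q ^ j * (1 - q) ^ (n - j)

lemma bTerm_nonneg (n : ℕ) (q : ℝ) (h0 : 0 ≤ q) (h1 : q ≤ 1) (j : ℕ) : 0 ≤ bTerm n q j := by
  have : 0 ≤ 1 - q := by linarith
  unfold bTerm
  positivity

lemma bTerm_succ (n : ℕ) (q : ℝ) (j : ℕ) :
    bTerm (n + 1) q (j + 1) = q * bTerm n q j + (1 - q) * bTerm n q (j + 1) := by
  unfold bTerm
  rw [Nat.choose_succ_succ, Nat.add_sub_add_right]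
  push_cast
  rcases lt_or_ge j n with h | h
  · obtain ⟨m, rfl⟩ : ∃ m, n = j + 1 + m := ⟨n - (j + 1), by omega⟩
    have e1 : j + 1 + m - j = m + 1 := by omega
    have e2 : j + 1 + m - (j + 1) = m := by omega
    rw [e1, e2]
    ring
  · rw [Nat.choose_eq_zero_of_lt (show n < j + 1 by omega)]
    push_cast
    ring

lemma binomTail_eq (n : ℕ) (q : ℝ) (k M : ℕ) (hM : n < M) :
    binomTail n q k = ∑ j ∈ Finset.Ico k M, bTerm n q j := by
  unfold binomTail
  apply Finset.sum_subset
  · intro j hj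
    simp only [Finset.mem_Icc, Finset.mem_Ico] at *
    omega
  · intro j hj hj'
    simp only [Finset.mem_Icc, Finset.mem_Ico] at *
    rw [Nat.choose_eq_zero_of_lt (by omega)]
    simp

lemma binomTail_succ (n : ℕ) (q : ℝ) (k : ℕ) :
    binomTail (n + 1) q (k + 1) = q * binomTail n q k + (1 - q) * binomTail n q (k + 1) := by
  rw [binomTail_eq (n + 1) q (k + 1) (n + 1 + 1) (by omega),
    binomTail_eq n q k (n + 1) (by omega),
    binomTail_eq n q (k + 1) (n + 1 + 1) (by omega), ← Finset.sum_Ico_add',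
    ← Finset.sum_Ico_add', Finset.mul_sum, Finset.mul_sum, ← Finset.sum_add_distrib]
  exact Finset.sum_congr rfl fun j _ => bTerm_succ n q j

lemma binomTail_zero (n : ℕ) (q : ℝ) : binomTail n q 0 = 1 := by
  rw [binomTail_eq n q 0 (n + 1) (by omega), ← Finset.range_eq_Ico]
  have h := add_pow q (1 - q) n
  rw [add_sub_cancel, one_pow] at h
  rw [h]
  refine Finset.sum_congr rfl fun j _ => ?_
  unfold bTerm
  ring

lemma binomTail_anti (n : ℕ) (q : ℝ) (h0 : 0 ≤ q) (h1 : q ≤ 1) (k : ℕ) :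
    binomTail n q (k + 1) ≤ binomTail n q k := by
  unfold binomTail
  apply Finset.sum_le_sum_of_subset_of_nonneg
  · intro j hj
    simp only [Finset.mem_Icc] at *
    omega
  · intro j _ _
    exact bTerm_nonneg n q h0 h1 j

lemma binomTail_mono (p q : ℝ) (h0 : 0 ≤ p) (hpq : p ≤ q) (h1 : q ≤ 1) (n : ℕ) :
    ∀ k, binomTail n p k ≤ binomTail n q k := by
  induction n with
  | zero =>
    intro k
    cases k with
    | zero => simp [binomTail_zero]
    | succ k => simp [binomTail]
  | succ n ih =>
    intro k
    cases k with
    | zero => simp [binomTail_zero]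
    | succ k =>
      rw [binomTail_succ, binomTail_succ]
      have a := mul_nonneg (sub_nonneg.2 hpq)
        (sub_nonneg.2 (binomTail_anti n p h0 (hpq.trans h1) k))
      have b := mul_le_mul_of_nonneg_left (ih k) (h0.trans hpq)
      have c := mul_le_mul_of_nonneg_left (ih (k + 1)) (sub_nonneg.2 h1)
      linarith

theorem stmt_13 (n : ℕ) (hn : 1 ≤ n) (α : ℝ) (hα : α ∈ Set.Ioo (0 : ℝ) 1)
    (p : ℝ) (hp : p ∈ Set.Icc (0 : ℝ) 1) :
    ∑ k ∈ (Finset.range (n + 1)).filter (fun k => p < clopperPearsonLower n α k),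
        (n.choose k : ℝ) * p ^ k * (1 - p) ^ (n - k) ≤ α := by
  classical
  set S := (Finset.range (n + 1)).filter (fun k => p < clopperPearsonLower n α k) with hS
  rcases S.eq_empty_or_nonempty with h | h
  · rw [h, Finset.sum_empty]
    exact hα.1.le
  · have hm := S.min'_mem h
    set k := S.min' h with hk
    have hlt : p < clopperPearsonLower n α k := (Finset.mem_filter.1 hm).2
    have hne : {q : ℝ | q ∈ Set.Icc (0 : ℝ) 1 ∧ binomTail n q k ≤ α}.Nonempty := by
      by_contra hcon
      rw [Set.not_nonempty_iff_eq_empty] at hcon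
      unfold clopperPearsonLower at hlt
      rw [hcon, Real.sSup_empty] at hlt
      linarith [hp.1]
    obtain ⟨q, ⟨hq, hqα⟩, hpq⟩ := exists_lt_of_lt_csSup hne hlt
    refine le_trans ?_ ((binomTail_mono p q hp.1 hpq.le hq.2 n k).trans hqα)
    unfold binomTail
    apply Finset.sum_le_sum_of_subset_of_nonneg
    · intro j hj
      have h1 := S.min'_le j hj
      have h2 := Finset.mem_range.1 (Finset.mem_filter.1 hj).1
      exact Finset.mem_Icc.2 ⟨h1, by omega⟩
    · intro j _ _
      exact bTerm_nonneg n p hp.1 hp.2 j
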